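/- arXiv:2408.05848 — 3 statements merged into one kernel-verified Lean document; each statement's English description precedes it below -/
import Mathlib

section
/- Let k ≠ 0, let Ω ⊆ ℝⁿ \ {0} be an open cone, and let P : Ω → ℝ be smooth, nowhere zero and positively k-homogeneous. Then the Lie bracket of the vector fields vᵢ and vⱼ satisfies [vᵢ, vⱼ](y) = (Pᵢ(y)/(k·P(y)))·vⱼ(y) − (Pⱼ(y)/(k·P(y)))·vᵢ(y) for all y ∈ Ω and all i, j ∈ {1,…,n}; in particular the distribution 𝒱_P spanned by v₁,…,vₙ is involutive. -/
/-- The `i`-th partial derivative `Pᵢ = ∂P/∂yⁱ`. -/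
noncomputable def partialDer {n : ℕ} (P : (Fin n → ℝ) → ℝ) (i : Fin n)
    (y : Fin n → ℝ) : ℝ :=
  fderiv ℝ P y (Pi.single i 1)

/-- The generator `vᵢ(y) = eᵢ − (Pᵢ(y)/(k·P(y)))·y` of the distribution `𝒱_P`. -/
noncomputable def vGen {n : ℕ} (k : ℝ) (P : (Fin n → ℝ) → ℝ) (i : Fin n)
    (y : Fin n → ℝ) : Fin n → ℝ :=
  Pi.single i 1 - (partialDer P i y / (k * P y)) • y

/-- The Lie bracket `[X,Y]` of two vector fields on `ℝⁿ`. -/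
noncomputable def lieB {n : ℕ} (X Y : (Fin n → ℝ) → (Fin n → ℝ))
    (y : Fin n → ℝ) : Fin n → ℝ :=
  fderiv ℝ Y y (X y) - fderiv ℝ X y (Y y)

/-- Euler's theorem: if `l ↦ P (l • y)` agrees with `l ^ k * P y` for `l > 0`, then
`dP(y)[y] = k * P y`. -/
theorem fderiv_apply_self_of_homogeneous {E : Type*} [NormedAddCommGroup E] [NormedSpace ℝ E]
    {P : E → ℝ} {k : ℝ} {y : E} (hd : DifferentiableAt ℝ P y)
    (hhom : ∀ l : ℝ, 0 < l → P (l • y) = l ^ k * P y) :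
    fderiv ℝ P y y = k * P y := by
  have hray : HasDerivAt (fun l : ℝ => l • y) y 1 := by
    simpa using (hasDerivAt_id (1 : ℝ)).smul_const y
  have hP : HasFDerivAt P (fderiv ℝ P y) ((1 : ℝ) • y) := by
    simpa using hd.hasFDerivAt
  have hcomp : HasDerivAt (fun l : ℝ => P (l • y)) (fderiv ℝ P y y) 1 :=
    hP.comp_hasDerivAt (1 : ℝ) hray
  have hpow : HasDerivAt (fun l : ℝ => l ^ k * P y) (k * P y) 1 := by
    simpa using (Real.hasDerivAt_rpow_const (x := 1) (p := k) (Or.inl one_ne_zero)).mul_const (P y)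
  refine hcomp.unique (hpow.congr_of_eventuallyEq ?_)
  filter_upwards [lt_mem_nhds (zero_lt_one' ℝ)] with l hl using hhom l hl

/-- Differentiating Euler's identity gives `D²P(y)[w, y] = (k - 1) * dP(y)[w]`. -/
theorem fderiv_fderiv_apply_self_of_euler {E : Type*} [NormedAddCommGroup E] [NormedSpace ℝ E]
    {P : E → ℝ} {k : ℝ} {y : E} (hd : DifferentiableAt ℝ P y)
    (hd₂ : DifferentiableAt ℝ (fderiv ℝ P) y)
    (heuler : ∀ᶠ z in nhds y, fderiv ℝ P z z = k * P z) (w : E) :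
    fderiv ℝ (fderiv ℝ P) y w y = (k - 1) * fderiv ℝ P y w := by
  have hleft := hd₂.hasFDerivAt.clm_apply (hasFDerivAt_id y)
  have hright := (hd.hasFDerivAt.const_mul k).congr_of_eventuallyEq heuler
  have h := congrArg (fun L : E →L[ℝ] ℝ => L w) (hleft.unique hright)
  simp at h
  linarith

/-- The derivative of the coefficient `Pᵢ / (k * P)`. -/
theorem hasFDerivAt_partialDer_div {n : ℕ} {P : (Fin n → ℝ) → ℝ} {k : ℝ} {y : Fin n → ℝ}
    (hd : DifferentiableAt ℝ P y) (hd₂ : DifferentiableAt ℝ (fderiv ℝ P) y)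
    (hkP : k * P y ≠ 0) (i : Fin n) :
    HasFDerivAt (fun z => partialDer P i z / (k * P z))
      (((k * P y) ^ 2)⁻¹ • ((k * P y) • (fderiv ℝ (fderiv ℝ P) y).flip (Pi.single i 1)
        - partialDer P i y • k • fderiv ℝ P y)) y := by
  have hnum : HasFDerivAt (partialDer P i)
      ((fderiv ℝ (fderiv ℝ P) y).flip (Pi.single i 1)) y := by
    have h := hd₂.hasFDerivAt.clm_apply (hasFDerivAt_const (Pi.single i (1 : ℝ)) y)
    rw [ContinuousLinearMap.comp_zero, zero_add] at h
    exact h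
  have hinv := (hasDerivAt_inv hkP).comp_hasFDerivAt y (hd.hasFDerivAt.const_mul k)
  refine (hnum.mul hinv).congr_fderiv ?_
  ext w
  simp
  field_simp
  ring

/-- The derivative of `vᵢ`, given that of its coefficient. -/
theorem fderiv_vGen_apply {n : ℕ} {P : (Fin n → ℝ) → ℝ} {k : ℝ} {i : Fin n} {y : Fin n → ℝ}
    {f' : (Fin n → ℝ) →L[ℝ] ℝ}
    (hf : HasFDerivAt (fun z => partialDer P i z / (k * P z)) f' y) (w : Fin n → ℝ) :
    fderiv ℝ (vGen k P i) y w = -((partialDer P i y / (k * P y)) • w + f' w • y) := by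
  have h : HasFDerivAt (vGen k P i) _ y :=
    (hf.smul (hasFDerivAt_id y)).const_sub (Pi.single i (1 : ℝ))
  rw [h.fderiv]
  simp

/-- Let `k ≠ 0`, let `Ω ⊆ ℝⁿ \ {0}` be an open cone, and let
`P : Ω → ℝ` be smooth, nowhere zero and positively `k`-homogeneous.  Then
`[vᵢ, vⱼ](y) = (Pᵢ(y)/(k·P(y)))·vⱼ(y) − (Pⱼ(y)/(k·P(y)))·vᵢ(y)` for all
`y ∈ Ω` and all `i, j`; in particular the distribution `𝒱_P` spanned by
`v₁, …, vₙ` is involutive. -/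
theorem statement0 {n : ℕ} (k : ℝ) (hk : k ≠ 0)
    (Ω : Set (Fin n → ℝ)) (hΩopen : IsOpen Ω)
    (hΩ0 : ∀ y ∈ Ω, y ≠ 0)
    (hΩcone : ∀ y ∈ Ω, ∀ l : ℝ, 0 < l → l • y ∈ Ω)
    (P : (Fin n → ℝ) → ℝ)
    (hPsmooth : ContDiffOn ℝ (⊤ : ℕ∞) P Ω)
    (hPne : ∀ y ∈ Ω, P y ≠ 0)
    (hPhom : ∀ y ∈ Ω, ∀ l : ℝ, 0 < l → P (l • y) = l ^ k * P y) :
    ∀ y ∈ Ω, ∀ i j : Fin n,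
      lieB (vGen k P i) (vGen k P j) y
          = (partialDer P i y / (k * P y)) • vGen k P j y
            - (partialDer P j y / (k * P y)) • vGen k P i y
      ∧ lieB (vGen k P i) (vGen k P j) y
          ∈ Submodule.span ℝ (Set.range fun m => vGen k P m y) := by
  intro y hy i j
  have hPy : ∀ z ∈ Ω, ContDiffAt ℝ (⊤ : ℕ∞) P z := fun z hz =>
    hPsmooth.contDiffAt (hΩopen.mem_nhds hz)
  have hdiff : ∀ z ∈ Ω, DifferentiableAt ℝ P z := fun z hz =>
    (hPy z hz).differentiableAt (by simp)
  have hd₂ : DifferentiableAt ℝ (fderiv ℝ P) y :=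
    ((hPy y hy).fderiv_right (m := 1) (by norm_cast)).differentiableAt (by simp)
  have hsymm : IsSymmSndFDerivAt ℝ P y :=
    (hPy y hy).isSymmSndFDerivAt (by simp; norm_cast)
  have heuler : ∀ z ∈ Ω, fderiv ℝ P z z = k * P z := fun z hz =>
    fderiv_apply_self_of_homogeneous (hdiff z hz) (hPhom z hz)
  have heuler₂ : ∀ w, fderiv ℝ (fderiv ℝ P) y y w = (k - 1) * fderiv ℝ P y w := fun w => by
    rw [hsymm.eq y w]
    exact fderiv_fderiv_apply_self_of_euler (hdiff y hy) hd₂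
      (Filter.eventually_of_mem (hΩopen.mem_nhds hy) heuler) w
  have hP0 := hPne y hy
  have hcoeff := hasFDerivAt_partialDer_div (hdiff y hy) hd₂ (mul_ne_zero hk hP0)
  have hbracket : lieB (vGen k P i) (vGen k P j) y
      = (partialDer P i y / (k * P y)) • vGen k P j y
        - (partialDer P j y / (k * P y)) • vGen k P i y := by
    unfold lieB
    rw [fderiv_vGen_apply (hcoeff i), fderiv_vGen_apply (hcoeff j)]
    have hcross : ∀ a b : Fin n, (((k * P y) ^ 2)⁻¹ •
        ((k * P y) • (fderiv ℝ (fderiv ℝ P) y).flip (Pi.single a 1)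
          - partialDer P a y • k • fderiv ℝ P y)) (vGen k P b y)
        = ((k * P y) ^ 2)⁻¹ * (k * P y * fderiv ℝ (fderiv ℝ P) y (Pi.single b 1) (Pi.single a 1)
          + (1 - k) * partialDer P a y * partialDer P b y) := fun a b => by
      simp only [vGen, smul_apply, sub_apply, map_sub,
        map_smul, ContinuousLinearMap.flip_apply, smul_eq_mul, heuler₂, heuler y hy]
      simp only [partialDer]
      field_simp
      ring
    rw [hcross, hcross, hsymm.eq (Pi.single i 1) (Pi.single j 1)]
    module
  refine ⟨hbracket, hbracket ▸ Submodule.sub_mem _ ?_ ?_⟩ <;>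
    exact Submodule.smul_mem _ _ (Submodule.subset_span ⟨_, rfl⟩)
end

section
/- In the coordinate spray setting, define in addition the vertical vectors ṽᵢ(x,y) = (0, eᵢ − (Pᵢ(x,y)/(k·P(x,y)))·y) ∈ ℝⁿ×ℝⁿ and the Liouville vector 𝒞(x,y) = (0, y). Then for every (x,y) ∈ U×Ω the space ℝⁿ×ℝⁿ is the internal direct sum span{h₁(x,y),…,hₙ(x,y)} ⊕ ℝ·S(x,y) ⊕ span{ṽ₁(x,y),…,ṽₙ(x,y)} ⊕ ℝ·𝒞(x,y), where the first and third summands each have dimension n − 1; i.e., T T M = ℋ_P ⊕ span{S} ⊕ 𝒱_P ⊕ span{𝒞}. -/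
/-- The horizontal coordinate vector field
`δᵢ(x,y) = (eᵢ, −(N¹ᵢ(x,y),…,Nⁿᵢ(x,y)))` associated with connection
coefficients `N^j_i`. -/
noncomputable def deltaH {n : ℕ}
    (N : Fin n → Fin n → ((Fin n → ℝ) × (Fin n → ℝ)) → ℝ) (i : Fin n)
    (p : (Fin n → ℝ) × (Fin n → ℝ)) : (Fin n → ℝ) × (Fin n → ℝ) :=
  (Pi.single i 1, -(fun j => N j i p))

/-- The spray vector `S(x,y) = ∑ᵢ yⁱ·δᵢ(x,y)`. -/
noncomputable def sprayVec {n : ℕ}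
    (N : Fin n → Fin n → ((Fin n → ℝ) × (Fin n → ℝ)) → ℝ)
    (p : (Fin n → ℝ) × (Fin n → ℝ)) : (Fin n → ℝ) × (Fin n → ℝ) :=
  ∑ i, p.2 i • deltaH N i p

/-- The vertical partial derivative `Pᵢ = ∂P/∂yⁱ` of a function on `U × Ω`. -/
noncomputable def vertDer {n : ℕ} (P : ((Fin n → ℝ) × (Fin n → ℝ)) → ℝ)
    (i : Fin n) (p : (Fin n → ℝ) × (Fin n → ℝ)) : ℝ :=
  fderiv ℝ P p (0, Pi.single i 1)

/-- The generator `hᵢ(x,y) = δᵢ(x,y) − (Pᵢ(x,y)/(k·P(x,y)))·S(x,y)` of the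
horizontal sub-distribution `ℋ_P`. -/
noncomputable def hGen {n : ℕ} (k : ℝ)
    (N : Fin n → Fin n → ((Fin n → ℝ) × (Fin n → ℝ)) → ℝ)
    (P : ((Fin n → ℝ) × (Fin n → ℝ)) → ℝ) (i : Fin n)
    (p : (Fin n → ℝ) × (Fin n → ℝ)) : (Fin n → ℝ) × (Fin n → ℝ) :=
  deltaH N i p - (vertDer P i p / (k * P p)) • sprayVec N p

/-- The vertical generator `ṽᵢ(x,y) = (0, eᵢ − (Pᵢ(x,y)/(k·P(x,y)))·y)` of the
vertical sub-distribution `𝒱_P`. -/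
noncomputable def vGenProd {n : ℕ} (k : ℝ)
    (P : ((Fin n → ℝ) × (Fin n → ℝ)) → ℝ) (i : Fin n)
    (p : (Fin n → ℝ) × (Fin n → ℝ)) : (Fin n → ℝ) × (Fin n → ℝ) :=
  (0, Pi.single i 1 - (vertDer P i p / (k * P p)) • p.2)

/-- The Liouville vector `𝒞(x,y) = (0, y)`. -/
def liouville {n : ℕ} (p : (Fin n → ℝ) × (Fin n → ℝ)) :
    (Fin n → ℝ) × (Fin n → ℝ) :=
  (0, p.2)

/-- If `φ y = 1`, the vectors `eᵢ - φ(eᵢ) y` span the kernel of `φ`. -/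
theorem span_range_single_sub_smul_eq_ker {n : ℕ} (φ : (Fin n → ℝ) →ₗ[ℝ] ℝ) {y : Fin n → ℝ}
    (hy : φ y = 1) :
    Submodule.span ℝ (Set.range fun i => Pi.single i 1 - φ (Pi.single i 1) • y)
      = LinearMap.ker φ := by
  apply le_antisymm
  · rw [Submodule.span_le]
    rintro _ ⟨i, rfl⟩
    simp [hy]
  · intro v hv
    have hv : φ v = 0 := hv
    have hsum : ∑ i, v i • (Pi.single i (1 : ℝ) : Fin n → ℝ) = v := (pi_eq_sum_univ' v).symm
    have key : v = ∑ i, v i • (Pi.single i (1 : ℝ) - φ (Pi.single i 1) • y) := by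
      have hφ : ∑ i, v i * φ (Pi.single i 1) = 0 := by
        rw [← hv, ← congrArg φ hsum, map_sum]
        simp
      simp only [smul_sub, Finset.sum_sub_distrib, hsum, smul_smul, ← Finset.sum_smul, hφ,
        zero_smul, sub_zero]
    rw [key]
    exact Submodule.sum_mem _ fun i _ =>
      Submodule.smul_mem _ _ (Submodule.subset_span ⟨i, rfl⟩)

/-- A decomposition `E = ker φ ⊕ ℝ y` transported along two linear maps into a module which
is the direct sum of their images. -/
theorem isInternal_map_ker_span_singleton {E V : Type*} [AddCommGroup E] [Module ℝ E]
    [AddCommGroup V] [Module ℝ V] (A B : E →ₗ[ℝ] V)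
    (hAB : Function.Bijective (A.coprod B)) (φ : E →ₗ[ℝ] ℝ) {y : E} (hy : φ y = 1) :
    DirectSum.IsInternal
      ![(LinearMap.ker φ).map A, Submodule.span ℝ {A y},
        (LinearMap.ker φ).map B, Submodule.span ℝ {B y}] := by
  have hker {v : E} {s : ℝ} (hv : φ v = 0) (h : v + s • y = 0) : v = 0 ∧ s = 0 := by
    have hs : s = 0 := by simpa [hv, hy] using congrArg φ h
    exact ⟨by simpa [hs] using h, hs⟩
  apply DirectSum.isInternal_submodule_of_iSupIndep_of_iSup_eq_top
  · rw [iSupIndep_iff_dfinsupp_lsum_injective, ← LinearMap.ker_eq_bot, LinearMap.ker_eq_bot']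
    classical
    intro m hm
    obtain ⟨v, hv, h0⟩ := (m 0).2
    obtain ⟨s, h1⟩ := Submodule.mem_span_singleton.1 (m 1).2
    obtain ⟨w, hw, h2⟩ := (m 2).2
    obtain ⟨t, h3⟩ := Submodule.mem_span_singleton.1 (m 3).2
    have hsum : A.coprod B (v + s • y, w + t • y) = 0 := by
      rw [← hm, DFinsupp.lsum_apply_apply, DFinsupp.sumAddHom_apply,
        DFinsupp.sum_eq_sum_fintype _ (by simp)]
      simp [Fin.sum_univ_four, ← h0, ← h1, ← h2, ← h3]
      abel
    have hz := hAB.1 (hsum.trans (map_zero _).symm)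
    rw [Prod.mk_eq_zero] at hz
    obtain ⟨rfl, rfl⟩ := hker hv hz.1
    obtain ⟨rfl, rfl⟩ := hker hw hz.2
    ext i
    fin_cases i
    · simpa using h0.symm
    · simpa using h1.symm
    · simpa using h2.symm
    · simpa using h3.symm
  · rw [eq_top_iff]
    intro p _
    obtain ⟨⟨v, w⟩, rfl⟩ := hAB.2 p
    have hdec (u : E) : (u - φ u • y) + φ u • y = u := sub_add_cancel _ _
    have hmem (u : E) : u - φ u • y ∈ LinearMap.ker φ := by simp [hy]
    rw [LinearMap.coprod_apply, ← hdec v, ← hdec w, map_add, map_add, map_smul A (φ v),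
      map_smul B (φ w)]
    refine add_mem (add_mem ?_ ?_) (add_mem ?_ ?_)
    · exact Submodule.mem_iSup_of_mem (0 : Fin 4) (Submodule.mem_map_of_mem (hmem v))
    · exact Submodule.mem_iSup_of_mem (1 : Fin 4)
        (Submodule.smul_mem _ _ (Submodule.mem_span_singleton_self _))
    · exact Submodule.mem_iSup_of_mem (2 : Fin 4) (Submodule.mem_map_of_mem (hmem w))
    · exact Submodule.mem_iSup_of_mem (3 : Fin 4)
        (Submodule.smul_mem _ _ (Submodule.mem_span_singleton_self _))

/-- The horizontal lift `v ↦ ∑ᵢ vⁱ·δᵢ(x,y)`. -/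
noncomputable def horizontalLift {n : ℕ}
    (N : Fin n → Fin n → ((Fin n → ℝ) × (Fin n → ℝ)) → ℝ)
    (p : (Fin n → ℝ) × (Fin n → ℝ)) : (Fin n → ℝ) →ₗ[ℝ] (Fin n → ℝ) × (Fin n → ℝ) :=
  Fintype.linearCombination ℝ fun i => deltaH N i p

theorem horizontalLift_single {n : ℕ}
    (N : Fin n → Fin n → ((Fin n → ℝ) × (Fin n → ℝ)) → ℝ)
    (p : (Fin n → ℝ) × (Fin n → ℝ)) (i : Fin n) :
    horizontalLift N p (Pi.single i 1) = deltaH N i p := by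
  simp [horizontalLift]

theorem horizontalLift_snd {n : ℕ}
    (N : Fin n → Fin n → ((Fin n → ℝ) × (Fin n → ℝ)) → ℝ)
    (p : (Fin n → ℝ) × (Fin n → ℝ)) : horizontalLift N p p.2 = sprayVec N p := rfl

theorem fst_horizontalLift {n : ℕ}
    (N : Fin n → Fin n → ((Fin n → ℝ) × (Fin n → ℝ)) → ℝ)
    (p : (Fin n → ℝ) × (Fin n → ℝ)) (v : Fin n → ℝ) : (horizontalLift N p v).1 = v := by
  simp only [horizontalLift, Fintype.linearCombination_apply, Prod.fst_sum, Prod.smul_fst, deltaH]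
  exact (pi_eq_sum_univ' v).symm

theorem bijective_horizontalLift_coprod_inr {n : ℕ}
    (N : Fin n → Fin n → ((Fin n → ℝ) × (Fin n → ℝ)) → ℝ)
    (p : (Fin n → ℝ) × (Fin n → ℝ)) :
    Function.Bijective ((horizontalLift N p).coprod (LinearMap.inr ℝ (Fin n → ℝ) (Fin n → ℝ))) := by
  constructor
  · rw [← LinearMap.ker_eq_bot, LinearMap.ker_eq_bot']
    rintro ⟨v, w⟩ h
    have hv : v = 0 := by simpa [fst_horizontalLift] using congrArg Prod.fst h
    subst hv
    simpa using h
  · rintro ⟨a, b⟩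
    refine ⟨(a, b - (horizontalLift N p a).2), ?_⟩
    ext <;> simp [fst_horizontalLift]

/-- Euler's identity for a function positively `k`-homogeneous in the second variable. -/
theorem fderiv_snd_of_homogeneous {E F : Type*} [NormedAddCommGroup E] [NormedSpace ℝ E]
    [NormedAddCommGroup F] [NormedSpace ℝ F] {k : ℝ} {P : E × F → ℝ} {x : E} {y : F}
    (hP : DifferentiableAt ℝ P (x, y))
    (hhom : ∀ l : ℝ, 0 < l → P (x, l • y) = l ^ k * P (x, y)) :
    fderiv ℝ P (x, y) (0, y) = k * P (x, y) := by
  have hcurve : HasDerivAt (fun l : ℝ => (x, l • y)) (0, y) 1 := by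
    simpa using (hasDerivAt_const (1 : ℝ) x).prodMk ((hasDerivAt_id (1 : ℝ)).smul_const y)
  have hleft : HasDerivAt (fun l : ℝ => P (x, l • y)) (fderiv ℝ P (x, y) (0, y)) 1 := by
    have hP' : HasFDerivAt P (fderiv ℝ P (x, y)) (x, (1 : ℝ) • y) := by
      simpa using hP.hasFDerivAt
    exact hP'.comp_hasDerivAt 1 hcurve
  have hright : HasDerivAt (fun l : ℝ => l ^ k * P (x, y)) (k * P (x, y)) 1 := by
    simpa using (Real.hasDerivAt_rpow_const (p := k) (Or.inl one_ne_zero)).mul_const (P (x, y))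
  refine hleft.unique (hright.congr_of_eventuallyEq ?_)
  filter_upwards [lt_mem_nhds one_pos] with l hl using hhom l hl

/-- In the coordinate spray setting, for every
`(x,y) ∈ U×Ω` the space `ℝⁿ×ℝⁿ` is the internal direct sum
`span{h₁,…,hₙ} ⊕ ℝ·S ⊕ span{ṽ₁,…,ṽₙ} ⊕ ℝ·𝒞`, where the first and third
summands each have dimension `n − 1`; i.e.
`TTM = ℋ_P ⊕ span{S} ⊕ 𝒱_P ⊕ span{𝒞}`. -/
theorem statement4 {n : ℕ} (k : ℝ) (hk : k ≠ 0)
    (U : Set (Fin n → ℝ)) (hU : IsOpen U)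
    (Ω : Set (Fin n → ℝ)) (hΩopen : IsOpen Ω)
    (hΩ0 : ∀ y ∈ Ω, y ≠ 0)
    (hΩcone : ∀ y ∈ Ω, ∀ l : ℝ, 0 < l → l • y ∈ Ω)
    (N : Fin n → Fin n → ((Fin n → ℝ) × (Fin n → ℝ)) → ℝ)
    (hN : ∀ i j, ContDiffOn ℝ (⊤ : ℕ∞) (N i j) (U ×ˢ Ω))
    (P : ((Fin n → ℝ) × (Fin n → ℝ)) → ℝ)
    (hPsmooth : ContDiffOn ℝ (⊤ : ℕ∞) P (U ×ˢ Ω))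
    (hPne : ∀ p ∈ U ×ˢ Ω, P p ≠ 0)
    (hPhom : ∀ x ∈ U, ∀ y ∈ Ω, ∀ l : ℝ, 0 < l →
      P (x, l • y) = l ^ k * P (x, y)) :
    ∀ x ∈ U, ∀ y ∈ Ω,
      DirectSum.IsInternal
        ![Submodule.span ℝ (Set.range fun i => hGen k N P i (x, y)),
          Submodule.span ℝ {sprayVec N (x, y)},
          Submodule.span ℝ (Set.range fun i => vGenProd k P i (x, y)),
          Submodule.span ℝ {liouville (x, y)}]
      ∧ Module.finrank ℝ
          (Submodule.span ℝ (Set.range fun i => hGen k N P i (x, y))) = n - 1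
      ∧ Module.finrank ℝ
          (Submodule.span ℝ (Set.range fun i => vGenProd k P i (x, y)))
            = n - 1 := by
  intro x hx y hy
  have hdiff : DifferentiableAt ℝ P (x, y) :=
    (hPsmooth.contDiffAt ((hU.prod hΩopen).mem_nhds ⟨hx, hy⟩)).differentiableAt (by simp)
  have hkP : k * P (x, y) ≠ 0 := mul_ne_zero hk (hPne _ ⟨hx, hy⟩)
  let φ : (Fin n → ℝ) →ₗ[ℝ] ℝ := (k * P (x, y))⁻¹ •
    ((fderiv ℝ P (x, y)).toLinearMap ∘ₗ LinearMap.inr ℝ (Fin n → ℝ) (Fin n → ℝ))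
  have hφ (i : Fin n) : φ (Pi.single i 1) = vertDer P i (x, y) / (k * P (x, y)) := by
    simp [φ, vertDer, div_eq_inv_mul]
  have hφy : φ y = 1 := by
    simp only [φ, LinearMap.smul_apply, LinearMap.comp_apply, LinearMap.inr_apply,
      ContinuousLinearMap.coe_coe, smul_eq_mul,
      fderiv_snd_of_homogeneous hdiff (hPhom x hx y hy)]
    exact inv_mul_cancel₀ hkP
  have hbij := bijective_horizontalLift_coprod_inr N (x, y)
  have hH : Submodule.span ℝ (Set.range fun i => hGen k N P i (x, y))
      = (LinearMap.ker φ).map (horizontalLift N (x, y)) := by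
    rw [← span_range_single_sub_smul_eq_ker φ hφy, Submodule.map_span, ← Set.range_comp]
    congr 2 with i : 1
    simp only [Function.comp_apply, map_sub, map_smul, horizontalLift_single, hφ, hGen,
      ← horizontalLift_snd]
  have hV : Submodule.span ℝ (Set.range fun i => vGenProd k P i (x, y))
      = (LinearMap.ker φ).map (LinearMap.inr ℝ (Fin n → ℝ) (Fin n → ℝ)) := by
    rw [← span_range_single_sub_smul_eq_ker φ hφy, Submodule.map_span, ← Set.range_comp]
    congr 2 with i : 1
    simp only [Function.comp_apply, LinearMap.inr_apply, hφ, vGenProd]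
  have hrank : Module.finrank ℝ (LinearMap.ker φ) = n - 1 := by
    have hφ0 : φ ≠ 0 := fun h => by simp [h] at hφy
    have := Module.Dual.finrank_ker_add_one_of_ne_zero (f := φ) hφ0
    rw [Module.finrank_fin_fun] at this
    omega
  have hinj : Function.Injective (horizontalLift N (x, y)) :=
    Function.LeftInverse.injective (g := Prod.fst) (fst_horizontalLift N (x, y))
  rw [hH, hV]
  exact ⟨isInternal_map_ker_span_singleton _ _ hbij φ hφy,
    (Submodule.equivMapOfInjective _ hinj _).symm.finrank_eq.trans hrank,
    (Submodule.equivMapOfInjective _ LinearMap.inr_injective _).symm.finrank_eq.trans hrank⟩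
end

section
/- Let n ≥ 2, let U ⊆ ℝⁿ be open and connected, and let F, P : U×(ℝⁿ \ {0}) → ℝ be smooth, everywhere positive, and positively 1-homogeneous in y. Suppose P is 𝒱_F-invariant, i.e. ∂P/∂yⁱ(x,y) = ((∂F/∂yⁱ)(x,y)/F(x,y))·P(x,y) for all (x,y) and all i, and suppose that both F and P are S-invariant for a spray with smooth coefficients Gⁱ : U×(ℝⁿ \ {0}) → ℝ. Then there exists a constant c > 0 such that P = c·F on U×(ℝⁿ \ {0}). -/
/-- A function `f` on `U × (ℝⁿ \ {0})` is `S`-invariant (geodesically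
invariant) for the spray `S = yⁱ ∂/∂xⁱ − 2Gⁱ ∂/∂yⁱ` with coefficients `Gⁱ`
if `∑ᵢ yⁱ·∂f/∂xⁱ − 2∑ᵢ Gⁱ·∂f/∂yⁱ = 0` on the domain `D`. -/
def SInvariant {n : ℕ} (G : Fin n → ((Fin n → ℝ) × (Fin n → ℝ)) → ℝ)
    (D : Set ((Fin n → ℝ) × (Fin n → ℝ)))
    (f : ((Fin n → ℝ) × (Fin n → ℝ)) → ℝ) : Prop :=
  ∀ p ∈ D,
    (∑ i, p.2 i * fderiv ℝ f p (Pi.single i 1, 0))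
      - 2 * ∑ i, G i p * fderiv ℝ f p (0, Pi.single i 1) = 0

theorem ContinuousLinearMap.apply_eq_sum_single {n : ℕ} (L : (Fin n → ℝ) →L[ℝ] ℝ)
    (v : Fin n → ℝ) : L v = ∑ i, v i * L (Pi.single i 1) := by
  conv_lhs => rw [← Finset.univ_sum_single v]
  rw [map_sum]
  refine Finset.sum_congr rfl fun i _ => ?_
  rw [← smul_eq_mul, ← map_smul, ← Pi.single_smul, smul_eq_mul, mul_one]

theorem isPreconnected_setOf_ne_zero {n : ℕ} (hn : 2 ≤ n) :
    IsPreconnected {y : Fin n → ℝ | y ≠ 0} := by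
  have hrank : 1 < Module.rank ℝ (Fin n → ℝ) := by
    rw [rank_fin_fun]
    exact_mod_cast hn
  exact (isConnected_compl_singleton_of_one_lt_rank hrank 0).isPreconnected

/-- A differentiable function on `U × (ℝⁿ \ {0})` whose vertical derivatives vanish and whose
derivative at `(x, y)` along the horizontal vector `(y, 0)` vanishes is constant. -/
theorem eq_of_fderiv_vertical_eq_zero_of_fderiv_horizontal_eq_zero {n : ℕ} (hn : 2 ≤ n)
    {U : Set (Fin n → ℝ)} (hUo : IsOpen U) (hUc : IsPreconnected U)
    {h : (Fin n → ℝ) × (Fin n → ℝ) → ℝ}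
    (hd : ∀ p ∈ U ×ˢ {y : Fin n → ℝ | y ≠ 0}, DifferentiableAt ℝ h p)
    (hv : ∀ p ∈ U ×ˢ {y : Fin n → ℝ | y ≠ 0}, ∀ v, fderiv ℝ h p (0, v) = 0)
    (hh : ∀ p ∈ U ×ˢ {y : Fin n → ℝ | y ≠ 0}, fderiv ℝ h p (p.2, 0) = 0)
    {p q : (Fin n → ℝ) × (Fin n → ℝ)} (hp : p ∈ U ×ˢ {y : Fin n → ℝ | y ≠ 0})
    (hq : q ∈ U ×ˢ {y : Fin n → ℝ | y ≠ 0}) : h p = h q := by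
  have hVo : IsOpen {y : Fin n → ℝ | y ≠ 0} := isOpen_ne
  have hVc := isPreconnected_setOf_ne_zero hn
  have hvert : ∀ x ∈ U, ∀ y z : Fin n → ℝ, y ≠ 0 → z ≠ 0 → h (x, y) = h (x, z) := by
    intro x hx y z hy hz
    have key : ∀ w : Fin n → ℝ, w ≠ 0 → HasFDerivAt (fun w => h (x, w)) (0 : (Fin n → ℝ) →L[ℝ] ℝ) w := by
      intro w hw
      have hxw : (x, w) ∈ U ×ˢ {y : Fin n → ℝ | y ≠ 0} := ⟨hx, hw⟩
      have := (hd _ hxw).hasFDerivAt.comp w (hasFDerivAt_prodMk_right x w)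
      refine this.congr_fderiv ?_
      ext1 v
      simpa using hv _ hxw v
    exact hVo.is_const_of_fderiv_eq_zero hVc
      (fun w hw => (key w hw).differentiableAt.differentiableWithinAt)
      (fun w hw => (key w hw).fderiv) hy hz
  have hhor : ∀ x ∈ U, ∀ y : Fin n → ℝ, y ≠ 0 → ∀ w : Fin n → ℝ,
      fderiv ℝ h (x, y) (w, 0) = 0 := by
    intro x hx y hy w
    rcases eq_or_ne w 0 with rfl | hw
    · exact map_zero (fderiv ℝ h (x, y))
    have hy' : HasFDerivAt (fun u => h (u, y))
        ((fderiv ℝ h (x, y)).comp (ContinuousLinearMap.inl ℝ _ _)) x :=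
      HasFDerivAt.comp x (f := fun u => (u, y)) (hd (x, y) ⟨hx, hy⟩).hasFDerivAt
        (hasFDerivAt_prodMk_left x y)
    have hw' : HasFDerivAt (fun u => h (u, w))
        ((fderiv ℝ h (x, w)).comp (ContinuousLinearMap.inl ℝ _ _)) x :=
      HasFDerivAt.comp x (f := fun u => (u, w)) (hd (x, w) ⟨hx, hw⟩).hasFDerivAt
        (hasFDerivAt_prodMk_left x w)
    have heq : (fun u => h (u, y)) =ᶠ[nhds x] fun u => h (u, w) := by
      filter_upwards [hUo.mem_nhds hx] with u hu using hvert u hu y w hy hw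
    have := congrArg (fun L => L w) (hy'.unique (hw'.congr_of_eventuallyEq heq))
    simp only [ContinuousLinearMap.comp_apply, ContinuousLinearMap.inl_apply] at this
    rw [this]
    exact hh (x, w) ⟨hx, hw⟩
  refine (hUo.prod hVo).is_const_of_fderiv_eq_zero (hUc.prod hVc)
    (fun r hr => (hd r hr).differentiableWithinAt) (fun r hr => ?_) hp hq
  ext1
  · ext1 w
    simpa using hhor r.1 hr.1 r.2 hr.2 w
  · ext1 w
    simpa using hv r hr w

/-- Let `n ≥ 2`, let `U ⊆ ℝⁿ` be open and connected, and let
`F, P : U×(ℝⁿ \ {0}) → ℝ` be smooth, positive and positively 1-homogeneous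
in `y`.  If `P` is `𝒱_F`-invariant, i.e.
`∂P/∂yⁱ = ((∂F/∂yⁱ)/F)·P` for all `i`, and both `F` and `P` are
`S`-invariant for a spray with smooth coefficients `Gⁱ`, then there is a
constant `c > 0` with `P = c·F` on `U×(ℝⁿ \ {0})`. -/
theorem statement7 {n : ℕ} (hn : 2 ≤ n)
    (U : Set (Fin n → ℝ)) (hUopen : IsOpen U) (hUconn : IsConnected U)
    (G : Fin n → ((Fin n → ℝ) × (Fin n → ℝ)) → ℝ)
    (hG : ∀ i, ContDiffOn ℝ (⊤ : ℕ∞) (G i) (U ×ˢ {y : Fin n → ℝ | y ≠ 0}))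
    (F P : ((Fin n → ℝ) × (Fin n → ℝ)) → ℝ)
    (hFsmooth : ContDiffOn ℝ (⊤ : ℕ∞) F (U ×ˢ {y : Fin n → ℝ | y ≠ 0}))
    (hPsmooth : ContDiffOn ℝ (⊤ : ℕ∞) P (U ×ˢ {y : Fin n → ℝ | y ≠ 0}))
    (hFpos : ∀ p ∈ U ×ˢ {y : Fin n → ℝ | y ≠ 0}, 0 < F p)
    (hPpos : ∀ p ∈ U ×ˢ {y : Fin n → ℝ | y ≠ 0}, 0 < P p)
    (hFhom : ∀ p ∈ U ×ˢ {y : Fin n → ℝ | y ≠ 0}, ∀ l : ℝ, 0 < l →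
      F (p.1, l • p.2) = l * F p)
    (hPhom : ∀ p ∈ U ×ˢ {y : Fin n → ℝ | y ≠ 0}, ∀ l : ℝ, 0 < l →
      P (p.1, l • p.2) = l * P p)
    (hVF : ∀ p ∈ U ×ˢ {y : Fin n → ℝ | y ≠ 0}, ∀ i : Fin n,
      fderiv ℝ P p (0, Pi.single i 1)
        = (fderiv ℝ F p (0, Pi.single i 1) / F p) * P p)
    (hFinv : SInvariant G (U ×ˢ {y : Fin n → ℝ | y ≠ 0}) F)
    (hPinv : SInvariant G (U ×ˢ {y : Fin n → ℝ | y ≠ 0}) P) :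
    ∃ c : ℝ, 0 < c ∧ ∀ p ∈ U ×ˢ {y : Fin n → ℝ | y ≠ 0}, P p = c * F p := by
  set D := U ×ˢ {y : Fin n → ℝ | y ≠ 0} with hD
  have hDo : IsOpen D := hUopen.prod isOpen_ne
  have hFd : ∀ p ∈ D, DifferentiableAt ℝ F p := fun p hp =>
    (hFsmooth.contDiffAt (hDo.mem_nhds hp)).differentiableAt (by simp)
  have hPd : ∀ p ∈ D, DifferentiableAt ℝ P p := fun p hp =>
    (hPsmooth.contDiffAt (hDo.mem_nhds hp)).differentiableAt (by simp)
  have hd : ∀ p ∈ D, DifferentiableAt ℝ (fun q => P q / F q) p := fun p hp =>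
    by
    simpa only [div_eq_mul_inv] using (hPd p hp).fun_mul ((hFd p hp).fun_inv (hFpos p hp).ne')
  have hquot : ∀ p ∈ D, ∀ v, F p * fderiv ℝ (fun q => P q / F q) p v
      = fderiv ℝ P p v - P p / F p * fderiv ℝ F p v := by
    intro p hp v
    have heq : P =ᶠ[nhds p] fun q => P q / F q * F q := by
      filter_upwards [hDo.mem_nhds hp] with q hq
      rw [div_mul_cancel₀ _ (hFpos q hq).ne']
    rw [heq.fderiv_eq, fderiv_fun_mul (hd p hp) (hFd p hp)]
    simp
  have hbasis : ∀ p ∈ D, ∀ i, fderiv ℝ (fun q => P q / F q) p (0, Pi.single i 1) = 0 := by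
    intro p hp i
    refine (mul_eq_zero.1 ?_).resolve_left (hFpos p hp).ne'
    rw [hquot p hp, hVF p hp i]
    ring
  have hvert : ∀ p ∈ D, ∀ v, fderiv ℝ (fun q => P q / F q) p (0, v) = 0 := by
    intro p hp v
    have := ContinuousLinearMap.apply_eq_sum_single
      ((fderiv ℝ (fun q => P q / F q) p).comp (ContinuousLinearMap.inr ℝ _ _)) v
    simpa [hbasis p hp] using this
  have hhor : ∀ p ∈ D, fderiv ℝ (fun q => P q / F q) p (p.2, 0) = 0 := by
    intro p hp
    have hexp : ∀ f : (Fin n → ℝ) × (Fin n → ℝ) → ℝ, fderiv ℝ f p (p.2, 0)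
        = ∑ i, p.2 i * fderiv ℝ f p (Pi.single i 1, 0) := fun f =>
      ContinuousLinearMap.apply_eq_sum_single
        ((fderiv ℝ f p).comp (ContinuousLinearMap.inl ℝ _ _)) p.2
    have hF := hFinv p hp
    have hP := hPinv p hp
    rw [← hexp] at hF hP
    have hG' : ∑ i, G i p * fderiv ℝ P p (0, Pi.single i 1)
        = P p / F p * ∑ i, G i p * fderiv ℝ F p (0, Pi.single i 1) := by
      rw [Finset.mul_sum]
      refine Finset.sum_congr rfl fun i _ => ?_
      rw [hVF p hp i]
      ring
    refine (mul_eq_zero.1 ?_).resolve_left (hFpos p hp).ne'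
    rw [hquot p hp]
    rw [hG'] at hP
    linear_combination hP - P p / F p * hF
  obtain ⟨x, hx⟩ := hUconn.nonempty
  have hq : (x, fun _ => 1) ∈ D := ⟨hx, fun h0 => one_ne_zero (congrFun h0 ⟨0, by omega⟩)⟩
  refine ⟨_, div_pos (hPpos _ hq) (hFpos _ hq), fun p hp => ?_⟩
  rw [← div_eq_iff (hFpos p hp).ne']
  exact eq_of_fderiv_vertical_eq_zero_of_fderiv_horizontal_eq_zero hn hUopen
    hUconn.isPreconnected hd hvert hhor hp hq
end
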